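/- A real n×n matrix A has all eigenvalues with positive real parts if and only if there exists a symmetric positive definite matrix G such that GA + AᵀG is positive definite. -/

import Mathlib

open Matrix

section BanachAlgebra

variable {R : Type*} [NormedRing R] [NormedAlgebra ℂ R] [CompleteSpace R]

/-- If the spectrum lies in the open unit disc, some positive power has norm less than one. -/
theorem exists_norm_pow_succ_lt_one_of_spectrum {a : R} (ha : ∀ z ∈ spectrum ℂ a, ‖z‖ < 1) :
    ∃ N : ℕ, ‖a ^ (N + 1)‖ < 1 := by
  rcases subsingleton_or_nontrivial R with _ | _
  · exact ⟨0, by simp [Subsingleton.elim a 0]⟩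
  have hrad : spectralRadius ℂ a < ((1 : NNReal) : ENNReal) :=
    spectrum.spectralRadius_lt_of_forall_lt a fun z hz => by
      simpa [← NNReal.coe_lt_coe] using ha z hz
  have hlim := spectrum.pow_nnnorm_pow_one_div_tendsto_nhds_spectralRadius a
  obtain ⟨N, hN, hN0⟩ :=
    ((hlim.eventually_lt_const hrad).and (Filter.eventually_gt_atTop 0)).exists
  obtain ⟨N, rfl⟩ := Nat.exists_eq_succ_of_ne_zero hN0.ne'
  refine ⟨N, ?_⟩
  by_contra! h
  refine absurd hN (not_lt.mpr ?_)
  refine ENNReal.one_le_rpow ?_ (by positivity)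
  exact_mod_cast h

end BanachAlgebra

section Cayley

variable {R : Type*} [Ring R] [Algebra ℂ R]

theorem isUnit_add_one_of_spectrum_re_pos {a : R} (ha : ∀ z ∈ spectrum ℂ a, 0 < z.re) :
    IsUnit (a + 1) := by
  by_contra h
  have hmem : (-1 : ℂ) ∈ spectrum ℂ a := by
    rw [spectrum.mem_iff]
    contrapose! h
    rw [← IsUnit.neg_iff]
    convert h using 1
    simp only [map_neg, map_one]
    abel
  have := ha _ hmem
  norm_num at this

/-- The Cayley transform maps spectra in the right half plane into the open unit disc. -/
theorem norm_lt_one_of_mem_spectrum_cayley {a b : R} (ha : ∀ z ∈ spectrum ℂ a, 0 < z.re)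
    (hab : b * (a + 1) = a - 1) {z : ℂ} (hz : z ∈ spectrum ℂ b) : ‖z‖ < 1 := by
  by_contra! hnorm
  have hu := isUnit_add_one_of_spectrum_re_pos ha
  refine hz ?_
  have hmul : (algebraMap ℂ R z - b) * (a + 1) = (z - 1) • a + algebraMap ℂ R (z + 1) := by
    rw [sub_mul, hab, mul_add, mul_one, ← Algebra.smul_def, sub_smul, map_add, map_one, one_smul]
    abel
  suffices h : IsUnit ((z - 1) • a + algebraMap ℂ R (z + 1)) by
    rw [← hmul] at h
    exact hu.mul_right_iff.mp h
  rcases eq_or_ne z 1 with rfl | hz1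
  · simpa using (IsUnit.mk0 (1 + 1 : ℂ) (by norm_num)).map (algebraMap ℂ R)
  have hz1' : 1 - z ≠ 0 := sub_ne_zero.mpr hz1.symm
  have hnot : (1 + z) / (1 - z) ∉ spectrum ℂ a := by
    intro hmem
    have hpos := ha _ hmem
    have hsq : 1 ≤ z.re * z.re + z.im * z.im := by
      rw [← Complex.normSq_apply, Complex.normSq_eq_norm_sq]
      nlinarith
    have hre : ((1 + z) / (1 - z)).re
        = (1 - (z.re * z.re + z.im * z.im)) / Complex.normSq (1 - z) := by
      rw [Complex.div_re, ← add_div]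
      simp
      ring
    rw [hre] at hpos
    exact absurd hpos (not_lt.mpr
      (div_nonpos_of_nonpos_of_nonneg (by linarith) (Complex.normSq_nonneg _)))
  rw [spectrum.mem_iff, not_not] at hnot
  have hscale := ((IsUnit.mk0 _ hz1').map (algebraMap ℂ R)).mul hnot
  convert hscale using 1
  rw [mul_sub, ← map_mul, mul_div_cancel₀ _ hz1', ← Algebra.smul_def, sub_smul, sub_smul,
    add_comm 1 z]
  abel

end Cayley

section Real

variable {n : Type*} [Fintype n] [DecidableEq n]

open scoped Matrix.Norms.L2Operator in
/-- A real matrix whose complexification is a strict contraction satisfies `Bᵀ B < 1`. -/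
theorem posDef_one_sub_transpose_mul_self {B : Matrix n n ℝ} (hB : ‖B.map Complex.ofReal‖ < 1) :
    (1 - Bᵀ * B).PosDef := by
  refine PosDef.of_dotProduct_mulVec_pos ?_ fun x hx => ?_
  · simp [IsHermitian, conjTranspose_eq_transpose_of_trivial]
  set v : EuclideanSpace ℂ n := WithLp.toLp 2 (fun i => (x i : ℂ)) with hv
  have hle := l2_opNorm_mulVec (B.map Complex.ofReal) v
  have hmap : (B.map Complex.ofReal) *ᵥ v.ofLp = fun i => ((B *ᵥ x) i : ℂ) := by
    ext i
    simp [mulVec, dotProduct, hv]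
  have hnorm (y : n → ℝ) :
      ‖(WithLp.toLp 2 (fun i => (y i : ℂ)) : EuclideanSpace ℂ n)‖ ^ 2 = y ⬝ᵥ y := by
    rw [EuclideanSpace.norm_sq_eq]
    simp [dotProduct, sq]
  have hvpos : 0 < ‖v‖ := by
    rw [norm_pos_iff]
    intro h0
    refine hx (funext fun i => ?_)
    simpa [hv] using congrArg (fun w : EuclideanSpace ℂ n => w i) h0
  have hlt : ‖(EuclideanSpace.equiv n ℂ).symm ((B.map Complex.ofReal) *ᵥ v.ofLp)‖ < ‖v‖ :=
    hle.trans_lt (by nlinarith)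
  have hsq := pow_lt_pow_left₀ hlt (norm_nonneg _) two_ne_zero
  rw [hmap] at hsq
  have hlt' : (B *ᵥ x) ⬝ᵥ (B *ᵥ x) < x ⬝ᵥ x := by
    rw [← hnorm, ← hnorm]
    exact hsq
  rw [star_trivial, sub_mulVec, one_mulVec, dotProduct_sub, ← mulVec_mulVec, dotProduct_mulVec,
    vecMul_transpose]
  linarith

/-- **Stein's theorem**: a matrix with spectrum in the open unit disc is a strict contraction for
some positive definite form. -/
theorem exists_posDef_sub_transpose_mul_mul {B : Matrix n n ℝ}
    (hB : ∀ z ∈ spectrum ℂ (B.map Complex.ofReal), ‖z‖ < 1) :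
    ∃ G : Matrix n n ℝ, G.PosDef ∧ (G - Bᵀ * G * B).PosDef := by
  open scoped Matrix.Norms.L2Operator in
  obtain ⟨N, hN⟩ := exists_norm_pow_succ_lt_one_of_spectrum hB
  have hpow : (B.map Complex.ofReal) ^ (N + 1) = (B ^ (N + 1)).map Complex.ofReal :=
    (map_pow (Complex.ofRealHom.mapMatrix (m := n)) B (N + 1)).symm
  rw [hpow] at hN
  refine ⟨∑ k ∈ Finset.range (N + 1), (B ^ k)ᵀ * B ^ k, ?_, ?_⟩
  · rw [Finset.sum_range_succ']
    refine PosDef.posSemidef_add (posSemidef_sum _ fun k _ => ?_) ?_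
    · simpa [conjTranspose_eq_transpose_of_trivial] using
        posSemidef_conjTranspose_mul_self (B ^ (k + 1))
    · simpa using PosDef.one
  · convert posDef_one_sub_transpose_mul_self hN using 1
    have hshift : Bᵀ * (∑ k ∈ Finset.range (N + 1), (B ^ k)ᵀ * B ^ k) * B
        = ∑ k ∈ Finset.range (N + 1), (B ^ (k + 1))ᵀ * B ^ (k + 1) := by
      rw [Finset.mul_sum, Finset.sum_mul]
      refine Finset.sum_congr rfl fun k _ => ?_
      rw [pow_succ, transpose_mul]
      simp only [Matrix.mul_assoc]
    rw [hshift, ← Finset.sum_sub_distrib,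
      Finset.sum_range_sub' (fun k => (B ^ k)ᵀ * B ^ k)]
    simp

theorem exists_posDef_lyapunov_of_spectrum_re_pos {A : Matrix n n ℝ}
    (hA : ∀ μ ∈ spectrum ℂ (A.map Complex.ofReal), 0 < μ.re) :
    ∃ G : Matrix n n ℝ, G.PosDef ∧ (G * A + Aᵀ * G).PosDef := by
  let φ : Matrix n n ℝ →+* Matrix n n ℂ := Complex.ofRealHom.mapMatrix
  have hφ (M : Matrix n n ℝ) : φ M = M.map Complex.ofReal := rfl
  have hdet : IsUnit (A + 1).det := by
    have h := isUnit_add_one_of_spectrum_re_pos hA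
    rw [← hφ, ← map_one φ, ← map_add, isUnit_iff_isUnit_det, ← RingHom.map_det] at h
    simpa using h
  have hcayley : ((A - 1) * (A + 1)⁻¹) * (A + 1) = A - 1 := nonsing_inv_mul_cancel_right _ _ hdet
  generalize (A - 1) * (A + 1)⁻¹ = B at hcayley
  obtain ⟨G, hG, hGB⟩ := exists_posDef_sub_transpose_mul_mul (B := B) fun z hz =>
    norm_lt_one_of_mem_spectrum_cayley hA
      (by rw [← hφ, ← hφ, ← map_one φ, ← map_add, ← map_sub, ← map_mul, hcayley]) hz
  refine ⟨G, hG, ?_⟩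
  have hconj := hGB.conjTranspose_mul_mul_same (B := A + 1)
    (mulVec_injective_of_isUnit ((isUnit_iff_isUnit_det _).mpr hdet))
  rw [conjTranspose_eq_transpose_of_trivial] at hconj
  have hexp : (A + 1)ᵀ * (G - Bᵀ * G * B) * (A + 1) = (2 : ℝ) • (G * A + Aᵀ * G) := by
    have hassoc : (A + 1)ᵀ * (G - Bᵀ * G * B) * (A + 1)
        = (A + 1)ᵀ * G * (A + 1) - (B * (A + 1))ᵀ * G * (B * (A + 1)) := by
      rw [transpose_mul B]
      simp only [Matrix.mul_sub, Matrix.sub_mul, Matrix.mul_assoc]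
    rw [hassoc, hcayley, transpose_add, transpose_sub, transpose_one, two_smul]
    noncomm_ring
  rw [hexp] at hconj
  simpa [smul_smul] using hconj.smul (a := (2⁻¹ : ℝ)) (by norm_num)

theorem spectrum_re_pos_of_posDef_lyapunov {A G : Matrix n n ℝ} (hG : G.PosDef)
    (hGA : (G * A + Aᵀ * G).PosDef) {μ : ℂ} (hμ : μ ∈ spectrum ℂ (A.map Complex.ofReal)) :
    0 < μ.re := by
  rw [← spectrum_toLin', ← Module.End.hasEigenvalue_iff_mem_spectrum] at hμ
  obtain ⟨v, hv⟩ := hμ.exists_hasEigenvector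
  have hAv : (A.map Complex.ofReal) *ᵥ v = μ • v := by simpa using hv.apply_eq_smul
  set x : n → ℝ := fun i => (v i).re with hx
  set y : n → ℝ := fun i => (v i).im with hy
  have hAx : A *ᵥ x = μ.re • x - μ.im • y := by
    ext i
    simpa [mulVec, dotProduct, hx, hy] using congrArg Complex.re (congrFun hAv i)
  have hAy : A *ᵥ y = μ.re • y + μ.im • x := by
    ext i
    simpa [mulVec, dotProduct, hx, hy] using congrArg Complex.im (congrFun hAv i)
  have hsymm (u w : n → ℝ) : u ⬝ᵥ G *ᵥ w = w ⬝ᵥ G *ᵥ u := by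
    have hGt : Gᵀ = G := by
      simpa [IsHermitian, conjTranspose_eq_transpose_of_trivial] using hG.isHermitian
    rw [dotProduct_mulVec, ← mulVec_transpose, hGt, dotProduct_comm]
  have hform (u : n → ℝ) : u ⬝ᵥ (G * A + Aᵀ * G) *ᵥ u = 2 * (u ⬝ᵥ G *ᵥ (A *ᵥ u)) := by
    rw [add_mulVec, dotProduct_add, ← mulVec_mulVec, ← mulVec_mulVec, dotProduct_mulVec u Aᵀ,
      vecMul_transpose, hsymm (A *ᵥ u)]
    ring
  have hsum : x ⬝ᵥ (G * A + Aᵀ * G) *ᵥ x + y ⬝ᵥ (G * A + Aᵀ * G) *ᵥ y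
      = 2 * μ.re * (x ⬝ᵥ G *ᵥ x + y ⬝ᵥ G *ᵥ y) := by
    rw [hform, hform, hAx, hAy]
    simp only [mulVec_add, mulVec_sub, mulVec_smul, dotProduct_add, dotProduct_sub,
      dotProduct_smul, smul_eq_mul]
    rw [hsymm y x]
    ring
  have hne : x ≠ 0 ∨ y ≠ 0 := by
    by_contra! h
    exact hv.2 (funext fun i => Complex.ext (congrFun h.1 i) (congrFun h.2 i))
  have hpos {M : Matrix n n ℝ} (hM : M.PosDef) : 0 < x ⬝ᵥ M *ᵥ x + y ⬝ᵥ M *ᵥ y := by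
    rcases hne with h | h
    · exact add_pos_of_pos_of_nonneg (hM.dotProduct_mulVec_pos h)
        (hM.posSemidef.dotProduct_mulVec_nonneg y)
    · exact add_pos_of_nonneg_of_pos (hM.posSemidef.dotProduct_mulVec_nonneg x)
        (hM.dotProduct_mulVec_pos h)
  have hprod := hpos hGA
  rw [hsum] at hprod
  linarith [pos_of_mul_pos_left hprod (hpos hG).le]

end Real

theorem stmt8 (n : ℕ) (A : Matrix (Fin n) (Fin n) ℝ) :
    (∀ μ ∈ spectrum ℂ (A.map Complex.ofReal), 0 < μ.re) ↔
      ∃ G : Matrix (Fin n) (Fin n) ℝ, G.PosDef ∧ (G * A + Aᵀ * G).PosDef :=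
  ⟨exists_posDef_lyapunov_of_spectrum_re_pos,
    fun ⟨_, hG, hGA⟩ _ hμ => spectrum_re_pos_of_posDef_lyapunov hG hGA hμ⟩
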